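/- Let X = a·∂/∂x + b·∂/∂y + c·∂/∂z be a derivation on ℂ[x,y,z] with a, b, c homogeneous polynomials of the same degree m ≥ 1, and let n ≥ 1. Assume X admits no rational first integral of degree ≤ n. Then the number of pairwise non-associated irreducible homogeneous polynomials of degree exactly n in ℂ[x,y,z] that are invariant by X is at most (m(n³+6n²+11n+6) − n³ − 2n² + n + 2)/8. -/

import Mathlib

open MvPolynomial

/-- `D` admits a rational first integral of degree `e`: there are `ℂ`-linearly independent
homogeneous polynomials `F`, `G` of degree `e` with `G·D(F) = F·D(G)`. -/
def HasRatFirstIntegral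
    (D : Derivation ℂ (MvPolynomial (Fin 3) ℂ) (MvPolynomial (Fin 3) ℂ)) (e : ℕ) : Prop :=
  ∃ F G : MvPolynomial (Fin 3) ℂ, F.IsHomogeneous e ∧ G.IsHomogeneous e ∧
    LinearIndependent ℂ ![F, G] ∧ G * D F = F * D G

section CoeffDerivation

variable {σ A : Type*} [CommRing A] [Algebra ℂ A]

/-- The derivation of `MvPolynomial σ A` that applies `d` to every coefficient. -/
noncomputable def coeffDerivation (d : Derivation ℂ A A) :
    Derivation ℂ (MvPolynomial σ A) (MvPolynomial σ A) :=
  Derivation.mk'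
    { toFun := fun p => AddMonoidAlgebra.ofCoeff
        ((AddMonoidAlgebra.coeff p).mapRange d (map_zero d))
      map_add' := fun p q => by
        ext j
        exact d.map_add (coeff j p) (coeff j q)
      map_smul' := fun c p => by
        ext j
        exact d.map_smul c (coeff j p) }
    (fun p q => by
      classical
      ext j
      change d (coeff j (p * q)) = coeff j (p * _ + q * _)
      rw [coeff_add, mul_comm q, coeff_mul, coeff_mul, coeff_mul, map_sum,
        ← Finset.sum_add_distrib]
      refine Finset.sum_congr rfl fun x _ => ?_
      rw [d.leibniz, smul_eq_mul, smul_eq_mul, mul_comm (coeff x.2 q)]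
      rfl)

@[simp]
theorem coeff_coeffDerivation (d : Derivation ℂ A A) (p : MvPolynomial σ A) (j : σ →₀ ℕ) :
    coeff j (coeffDerivation d p) = d (coeff j p) := rfl

theorem coeffDerivation_C (d : Derivation ℂ A A) (a : A) :
    coeffDerivation d (C a : MvPolynomial σ A) = C (d a) := by
  classical
  ext j
  rw [coeff_coeffDerivation, coeff_C, coeff_C]
  split_ifs <;> simp

theorem coeffDerivation_X (d : Derivation ℂ A A) (i : σ) :
    coeffDerivation d (X i : MvPolynomial σ A) = 0 := by
  classical
  ext j
  rw [coeff_coeffDerivation, coeff_X]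
  split_ifs <;> simp

theorem coeffDerivation_monomial (d : Derivation ℂ A A) (s : σ →₀ ℕ) (a : A) :
    coeffDerivation d (monomial s a) = monomial s (d a) := by
  classical
  ext j
  rw [coeff_coeffDerivation, coeff_monomial, coeff_monomial]
  split_ifs <;> simp

theorem totalDegree_coeffDerivation_le (d : Derivation ℂ A A) (p : MvPolynomial σ A) :
    (coeffDerivation d p).totalDegree ≤ p.totalDegree := by
  refine totalDegree_le_of_support_subset fun j hj => ?_
  rw [mem_support_iff] at hj ⊢
  rintro h
  exact hj (by rw [coeff_coeffDerivation, h, map_zero])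

theorem pderiv_coeffDerivation (d : Derivation ℂ A A) (i : σ) (p : MvPolynomial σ A) :
    pderiv i (coeffDerivation d p) = coeffDerivation d (pderiv i p) := by
  induction p using MvPolynomial.induction_on' with
  | monomial s a =>
    rw [coeffDerivation_monomial, pderiv_monomial, pderiv_monomial, coeffDerivation_monomial,
      d.leibniz, Derivation.map_natCast, smul_zero, zero_add, smul_eq_mul, mul_comm]
  | add p q hp hq => simp only [map_add, hp, hq]

/-- The chain rule for evaluating a polynomial with varying coefficients. -/
theorem derivation_eval [Fintype σ] (d : Derivation ℂ A A) (x : σ → A) (p : MvPolynomial σ A) :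
    d (eval x p) = eval x (coeffDerivation d p) + ∑ i, d (x i) * eval x (pderiv i p) := by
  classical
  induction p using MvPolynomial.induction_on with
  | C a => simp [coeffDerivation_C]
  | add p q hp hq => simp only [map_add, hp, hq, mul_add, Finset.sum_add_distrib]; ring
  | mul_X p k hp =>
    simp only [map_mul, eval_X, Derivation.leibniz, smul_eq_mul, hp, coeffDerivation_X,
      pderiv_X, map_add, mul_zero, zero_add, mul_add, Finset.sum_add_distrib]
    have : ∑ i, d (x i) * (eval x p *
        eval x ((Pi.single (M := fun _ => MvPolynomial σ A) i 1 : σ → MvPolynomial σ A) k)) =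
        d (x k) * eval x p := by
      rw [Finset.sum_eq_single k]
      · simp
      · intro b _ hb
        simp [hb.symm]
      · simp
    rw [this, Finset.mul_sum]
    simp only [mul_left_comm]
    ring

/-- The coefficients of `p` have pairwise quotients that are constants of `d`. -/
def IsProjConst (d : Derivation ℂ A A) (p : MvPolynomial σ A) : Prop :=
  ∃ a b : A, a ≠ 0 ∧ C a * coeffDerivation d p = C b * p

protected theorem IsProjConst.pderiv {d : Derivation ℂ A A} {p : MvPolynomial σ A}
    (h : IsProjConst d p)
    (i : σ) : IsProjConst d (pderiv i p) := by
  obtain ⟨a, b, ha, h⟩ := h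
  refine ⟨a, b, ha, ?_⟩
  have := congrArg (MvPolynomial.pderiv i) h
  rwa [pderiv_C_mul, pderiv_C_mul, pderiv_coeffDerivation] at this

/-- A nonzero space of polynomials stable under coefficientwise derivations contains a nonzero
element whose coefficients have constant ratios. -/
theorem exists_isProjConst {W : Submodule A (MvPolynomial σ A)} (hW : W ≠ ⊥)
    {S : Set (Derivation ℂ A A)} (hS : ∀ d ∈ S, ∀ p ∈ W, coeffDerivation d p ∈ W) :
    ∃ p ∈ W, p ≠ 0 ∧ ∀ d ∈ S, IsProjConst d p := by
  classical
  obtain ⟨q, hqW, hq0⟩ := Submodule.exists_mem_ne_zero_of_ne_bot hW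
  have hex : ∃ N, ∃ p ∈ W, p ≠ 0 ∧ p.support.card = N := ⟨_, q, hqW, hq0, rfl⟩
  obtain ⟨p, hpW, hp0, hN⟩ := Nat.find_spec hex
  refine ⟨p, hpW, hp0, fun d hd => ?_⟩
  obtain ⟨j, hj⟩ := support_nonempty.mpr hp0
  have hpj : coeff j p ≠ 0 := mem_support_iff.mp hj
  refine ⟨coeff j p, d (coeff j p), hpj, ?_⟩
  by_contra hne
  set r := C (coeff j p) * coeffDerivation d p - C (d (coeff j p)) * p with hr
  have hr0 : r ≠ 0 := sub_ne_zero.mpr hne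
  have hrW : r ∈ W := by
    rw [hr, C_mul', C_mul']
    exact W.sub_mem (W.smul_mem _ (hS d hd p hpW)) (W.smul_mem _ hpW)
  have hlt : r.support.card < p.support.card := by
    refine Finset.card_lt_card (Finset.ssubset_iff_subset_ne.mpr ⟨fun k hk => ?_, fun h => ?_⟩)
    · rw [mem_support_iff] at hk ⊢
      intro h
      exact hk (by rw [hr, coeff_sub, coeff_C_mul, coeff_C_mul, coeff_coeffDerivation, h]; simp)
    · rw [← h, mem_support_iff] at hj
      exact hj (by rw [hr, coeff_sub, coeff_C_mul, coeff_C_mul, coeff_coeffDerivation]; ring)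
  rw [hN] at hlt
  exact Nat.find_min hex hlt ⟨r, hrW, hr0, rfl⟩

variable [IsDomain A]

theorem IsProjConst.eval_coeffDerivation {d : Derivation ℂ A A} {p : MvPolynomial σ A}
    (h : IsProjConst d p) {x : σ → A} (hx : eval x p = 0) :
    eval x (coeffDerivation d p) = 0 := by
  obtain ⟨a, b, ha, h⟩ := h
  have := congrArg (eval x) h
  simpa [hx, ha] using this

/-- A nonconstant prime factor of a polynomial with constant coefficient ratios is multiplied by
a scalar under the coefficientwise derivation. -/
theorem IsProjConst.exists_eq_C_mul_of_prime_dvd [UniqueFactorizationMonoid A]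
    {d : Derivation ℂ A A} {p q : MvPolynomial σ A}
    (hp : IsProjConst d p) (hp0 : p ≠ 0) (hq : Prime q) (hqp : q ∣ p) (hdeg : q.totalDegree ≠ 0) :
    ∃ l : A, coeffDerivation d q = C l * q := by
  have hq0 : q ≠ 0 := hq.ne_zero
  obtain ⟨a, b, ha, hab⟩ := hp
  have hndvd : ∀ c : A, c ≠ 0 → ¬ q ∣ C c := by
    rintro c hc ⟨r, hr⟩
    have hr0 : r ≠ 0 := by
      rintro rfl
      simp [hc] at hr
    have := congrArg totalDegree hr
    rw [totalDegree_C, totalDegree_mul_of_isDomain hq0 hr0] at this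
    omega
  obtain ⟨k, r, hr, rfl⟩ := WfDvdMonoid.max_power_factor hp0 hq.irreducible
  have hdvd : q ∣ coeffDerivation d q := by
    rcases k with _ | k
    · exact absurd (by simpa using hqp) hr
    · rw [Derivation.leibniz, Derivation.leibniz_pow] at hab
      simp only [smul_eq_mul, nsmul_eq_mul, Nat.add_sub_cancel] at hab
      have h1 : q ^ k * (C a * (((k + 1 : ℕ) : MvPolynomial σ A) * (r * coeffDerivation d q))) =
          q ^ k * (q * (C b * r - C a * coeffDerivation d r)) := by
        linear_combination hab
      have h2 : q ∣ C a * (((k + 1 : ℕ) : MvPolynomial σ A) * (r * coeffDerivation d q)) :=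
        ⟨_, mul_left_cancel₀ (pow_ne_zero k hq0) h1⟩
      have hk : ((k + 1 : ℕ) : A) ≠ 0 := by
        rw [← map_natCast (algebraMap ℂ A), Ne, FaithfulSMul.algebraMap_eq_zero_iff]
        exact_mod_cast k.succ_ne_zero
      rcases hq.dvd_or_dvd h2 with h | h
      · exact absurd h (hndvd a ha)
      · rcases hq.dvd_or_dvd h with h | h
        · exact absurd (by simpa using h) (hndvd _ hk)
        · exact (hq.dvd_or_dvd h).resolve_left hr
  obtain ⟨l, hl⟩ := hdvd
  by_cases hl0 : l = 0
  · exact ⟨0, by simp [hl, hl0]⟩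
  · have h := totalDegree_coeffDerivation_le d q
    rw [hl, totalDegree_mul_of_isDomain hq0 hl0] at h
    have : l.totalDegree = 0 := by omega
    rw [totalDegree_eq_zero_iff_eq_C] at this
    exact ⟨_, by rw [hl, mul_comm, ← this]⟩

end CoeffDerivation

/-- Two polynomials without common factor have a nonzero combination free of the first variable. -/
theorem exists_mem_span_pair_pderiv_zero_eq_zero {A : Type*} [CommRing A] [IsDomain A]
    [UniqueFactorizationMonoid A] {m : ℕ} {p q : MvPolynomial (Fin (m + 1)) A}
    (hp : Irreducible p) (hpq : ¬ p ∣ q) :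
    ∃ w ∈ Ideal.span {p, q}, w ≠ 0 ∧ pderiv 0 w = 0 := by
  set φ := finSuccEquiv A m
  suffices ∃ a b t, t ≠ 0 ∧ a * φ p + b * φ q = Polynomial.C t by
    obtain ⟨a, b, t, ht, h⟩ := this
    refine ⟨φ.symm (Polynomial.C t), ?_, ?_, ?_⟩
    · refine Ideal.mem_span_pair.mpr ⟨φ.symm a, φ.symm b, ?_⟩
      rw [← h]
      simp
    · simpa using ht
    · have : φ.symm (Polynomial.C t) = rename Fin.succ t := by
        rw [AlgEquiv.symm_apply_eq]
        clear h ht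
        induction t using MvPolynomial.induction_on with
        | C a => simp [φ, finSuccEquiv_apply]
        | add p q hp hq => simp only [map_add, hp, hq]
        | mul_X p i hp => simp only [map_mul, rename_X, φ, finSuccEquiv_X_succ, hp]
      rw [this]
      apply pderiv_eq_zero_of_notMem_vars
      intro h
      classical
      obtain ⟨i, -, hi⟩ := Finset.mem_image.mp (vars_rename _ _ h)
      exact Fin.succ_ne_zero i hi
  have hirr : Irreducible (φ p) := (MulEquiv.irreducible_iff φ.toMulEquiv).mpr hp
  have hnd : ¬ φ p ∣ φ q := fun h => hpq ((map_dvd_iff φ).mp h)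
  generalize φ p = f at hirr hnd
  generalize φ q = g at hnd
  by_cases hf : f.natDegree = 0
  · rw [Polynomial.natDegree_eq_zero] at hf
    obtain ⟨t, rfl⟩ := hf
    refine ⟨1, 0, t, ?_, by simp⟩
    rintro rfl
    exact hirr.ne_zero (by simp)
  have hprim := hirr.isPrimitive hf
  let K := FractionRing (MvPolynomial (Fin m) A)
  have hK := (hprim.irreducible_iff_irreducible_map_fraction_map (K := K)).mp hirr
  have hc := (hK.coprime_iff_not_dvd).mpr fun h =>
    hnd (hprim.dvd_of_fraction_map_dvd_fraction_map h)
  have hres : f.resultant g ≠ 0 := by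
    intro h
    have h2 := Polynomial.resultant_ne_zero _ _ hc
    apply h2
    rw [Polynomial.natDegree_map_eq_of_injective (IsFractionRing.injective _ K),
      Polynomial.natDegree_map_eq_of_injective (IsFractionRing.injective _ K),
      Polynomial.resultant_map_map, h, map_zero]
  obtain ⟨a, b, -, -, h⟩ := Polynomial.exists_mul_add_mul_eq_C_resultant f g le_rfl le_rfl
    (Or.inl hf)
  exact ⟨a, b, _, hres, by rw [← h]; ring⟩

section Elimination

variable {σ A : Type*} [CommRing A]

theorem totalDegree_pderiv_le (i : σ) (p : MvPolynomial σ A) :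
    (pderiv i p).totalDegree ≤ p.totalDegree - 1 := by
  classical
  refine Finset.sup_le fun j hj => ?_
  rw [mem_support_iff, coeff_pderiv] at hj
  have h : j + Finsupp.single i 1 ∈ p.support := mem_support_iff.mpr fun h => hj (by simp [h])
  have h2 := le_totalDegree h
  rw [Finsupp.sum_add_index' (fun _ => rfl) (fun _ _ _ => rfl),
    Finsupp.sum_single_index rfl] at h2
  omega

theorem pderiv_pderiv_comm (i j : σ) (p : MvPolynomial σ A) :
    pderiv i (pderiv j p) = pderiv j (pderiv i p) := by
  have h : ⁅(pderiv i : Derivation A (MvPolynomial σ A) (MvPolynomial σ A)),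
      (pderiv j : Derivation A (MvPolynomial σ A) (MvPolynomial σ A))⁆ = 0 := by
    classical
    refine derivation_ext fun k => ?_
    simp only [Derivation.commutator_apply, pderiv_X, Derivation.zero_apply]
    rw [Pi.single_apply, Pi.single_apply]
    split_ifs <;> simp
  have h2 := congrArg (fun d => d p) h
  exact sub_eq_zero.mp (by simpa [Derivation.commutator_apply] using h2)

theorem eq_C_of_pderiv_eq_zero [IsDomain A] [CharZero A] {p : MvPolynomial σ A}
    (h : ∀ i, pderiv i p = 0) : p = C (coeff 0 p) := by
  classical
  ext j
  rw [coeff_C]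
  split_ifs with h0
  · rw [h0]
  · obtain ⟨i, hi⟩ : ∃ i, j i ≠ 0 := by
      by_contra! hne
      exact h0 (Finsupp.ext fun i => (hne i).symm)
    have h2 := congrArg (coeff (j - Finsupp.single i 1)) (h i)
    rw [coeff_pderiv, tsub_add_cancel_of_le
      (Finsupp.single_le_iff.mpr (Nat.one_le_iff_ne_zero.mpr hi)), coeff_zero] at h2
    refine (mul_eq_zero.mp h2).resolve_right ?_
    exact Nat.cast_add_one_ne_zero _

/-- A polynomial in two of the variables `x` vanishing at `x`, whose coefficients have constant
ratios for `d` and `e`, vanishes identically unless `d` and `e` are parallel along these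
variables. -/
theorem IsProjConst.eq_zero_of_pderiv_zero_eq_zero [IsDomain A] [Algebra ℂ A]
    {d e : Derivation ℂ A A}
    {x : Fin 3 → A} (hx : d (x 1) * e (x 2) ≠ d (x 2) * e (x 1)) {p : MvPolynomial (Fin 3) A}
    (hd : IsProjConst d p) (he : IsProjConst e p) (h0 : pderiv 0 p = 0) (hpx : eval x p = 0) :
    p = 0 := by
  have : CharZero A := charZero_of_injective_algebraMap (FaithfulSMul.algebraMap_injective ℂ A)
  induction hN : p.totalDegree using Nat.strong_induction_on generalizing p with
  | _ N ih =>
  by_cases hN0 : N = 0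
  · rw [hN0, totalDegree_eq_zero_iff_eq_C] at hN
    rw [hN, eval_C] at hpx
    rw [hN, hpx, C_0]
  have hsum : ∀ {f : Derivation ℂ A A}, IsProjConst f p →
      f (x 1) * eval x (pderiv 1 p) + f (x 2) * eval x (pderiv 2 p) = 0 := fun {f} hf => by
    have h := derivation_eval f x p
    rw [hpx, map_zero, hf.eval_coeffDerivation hpx, Fin.sum_univ_three, h0] at h
    simpa using h.symm
  have h1 := hsum hd
  have h2 := hsum he
  have hsub : d (x 1) * e (x 2) - d (x 2) * e (x 1) ≠ 0 := sub_ne_zero.mpr hx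
  have hcomm : ∀ i, pderiv 0 (pderiv i p) = 0 := fun i => by
    rw [pderiv_pderiv_comm, h0, map_zero]
  have key : ∀ i, eval x (pderiv i p) = 0 → pderiv i p = 0 := fun i hi => by
    have hle := totalDegree_pderiv_le i p
    exact ih _ (by omega) (hd.pderiv i) (he.pderiv i) (hcomm i) hi rfl
  have h3 : pderiv 1 p = 0 := key 1 <| (mul_eq_zero.mp
    (show (d (x 1) * e (x 2) - d (x 2) * e (x 1)) * eval x (pderiv 1 p) = 0 by
      linear_combination e (x 2) * h1 - d (x 2) * h2)).resolve_left hsub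
  have h4 : pderiv 2 p = 0 := key 2 <| (mul_eq_zero.mp
    (show (d (x 1) * e (x 2) - d (x 2) * e (x 1)) * eval x (pderiv 2 p) = 0 by
      linear_combination d (x 1) * h2 - e (x 1) * h1)).resolve_left hsub
  have hC := eq_C_of_pderiv_eq_zero (p := p) fun i => by fin_cases i <;> assumption
  rw [hC, eval_C] at hpx
  rw [hC, hpx, C_0]

/-- An irreducible polynomial vanishing at `x` with `d`- and `e`-constant ratios of coefficients
divides every other such polynomial. -/
theorem Irreducible.dvd_of_eval_eq_zero [IsDomain A] [UniqueFactorizationMonoid A] [Algebra ℂ A]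
    {d e : Derivation ℂ A A}
    {x : Fin 3 → A} (hx : d (x 1) * e (x 2) ≠ d (x 2) * e (x 1)) {p q : MvPolynomial (Fin 3) A}
    (hp : Irreducible p) {a b a' b' : A}
    (hdp : coeffDerivation d p = C a * p) (hep : coeffDerivation e p = C b * p)
    (hdq : coeffDerivation d q = C a' * q) (heq : coeffDerivation e q = C b' * q)
    (hpx : eval x p = 0) (hqx : eval x q = 0) : p ∣ q := by
  by_contra hpq
  obtain ⟨w, hw, hw0, hw1⟩ := exists_mem_span_pair_pderiv_zero_eq_zero hp hpq
  let W : Submodule A (MvPolynomial (Fin 3) A) :=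
    (Ideal.span {p, q}).restrictScalars A ⊓ LinearMap.ker (pderiv 0 : Derivation A _ _).toLinearMap
  have hmem : ∀ v, v ∈ W ↔ v ∈ Ideal.span {p, q} ∧ pderiv 0 v = 0 := fun v => Iff.rfl
  have hWne : W ≠ ⊥ := fun h => hw0 (by
    have : w ∈ W := (hmem w).mpr ⟨hw, hw1⟩
    rwa [h, Submodule.mem_bot] at this)
  have hstab : ∀ {f : Derivation ℂ A A} {s t : A}, coeffDerivation f p = C s * p →
      coeffDerivation f q = C t * q → ∀ v ∈ W, coeffDerivation f v ∈ W := by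
    intro f s t hs ht v hv
    rw [hmem] at hv ⊢
    refine ⟨?_, by rw [pderiv_coeffDerivation, hv.2, map_zero]⟩
    obtain ⟨g, h, hgh⟩ := Ideal.mem_span_pair.mp hv.1
    refine Ideal.mem_span_pair.mpr ⟨coeffDerivation f g + C s * g,
      coeffDerivation f h + C t * h, ?_⟩
    rw [← hgh, map_add, Derivation.leibniz, Derivation.leibniz, hs, ht]
    simp only [smul_eq_mul]
    ring
  obtain ⟨v, hvW, hv0, hv⟩ := exists_isProjConst hWne (S := {d, e}) (by
    rintro f (rfl | rfl)
    · exact hstab hdp hdq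
    · exact hstab hep heq)
  refine hv0 (IsProjConst.eq_zero_of_pderiv_zero_eq_zero hx (hv d (by simp)) (hv e (by simp))
    ((hmem v).mp hvW).2 ?_)
  obtain ⟨g, h, hgh⟩ := Ideal.mem_span_pair.mp ((hmem v).mp hvW).1
  rw [← hgh, map_add, map_mul, map_mul, hpx, hqx, mul_zero, mul_zero, add_zero]

end Elimination

section Euler

variable {σ : Type*}

/-- The Euler derivation. -/
noncomputable def eulerDerivation (σ : Type*) :
    Derivation ℂ (MvPolynomial σ ℂ) (MvPolynomial σ ℂ) :=
  mkDerivation ℂ X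

theorem coeff_eulerDerivation (p : MvPolynomial σ ℂ) (j : σ →₀ ℕ) :
    coeff j (eulerDerivation σ p) = (j.degree : ℂ) * coeff j p := by
  classical
  induction p using MvPolynomial.induction_on' with
  | add p q hp hq => rw [map_add, coeff_add, coeff_add, hp, hq, mul_add]
  | monomial s a =>
    have : eulerDerivation σ (monomial s a) = monomial s ((s.degree : ℂ) * a) := by
      rw [eulerDerivation, mkDerivation_monomial, Finsupp.sum, Finsupp.degree_apply, Nat.cast_sum,
        Finset.sum_mul, map_sum, Finset.smul_sum]
      refine Finset.sum_congr rfl fun i hi => ?_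
      rw [smul_eq_mul, X, monomial_mul, mul_one, tsub_add_cancel_of_le
        (Finsupp.single_le_iff.mpr
          (Nat.one_le_iff_ne_zero.mpr (Finsupp.mem_support_iff.mp hi))), smul_monomial,
        smul_eq_mul, mul_comm]
    rw [this, coeff_monomial, coeff_monomial]
    split_ifs with h
    · rw [h]
    · rw [mul_zero]

theorem MvPolynomial.IsHomogeneous.eulerDerivation_eq {p : MvPolynomial σ ℂ} {n : ℕ}
    (hp : p.IsHomogeneous n) : eulerDerivation σ p = (n : MvPolynomial σ ℂ) * p := by
  ext j
  rw [coeff_eulerDerivation, ← map_natCast C, coeff_C_mul]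
  by_cases h : j.degree = n
  · rw [h]
  · rw [hp.coeff_eq_zero h, mul_zero, mul_zero]

theorem isHomogeneous_of_eulerDerivation_eq {p : MvPolynomial σ ℂ} {n : ℕ}
    (hp : eulerDerivation σ p = (n : MvPolynomial σ ℂ) * p) : p.IsHomogeneous n := by
  intro j hj
  have h := congrArg (coeff j) hp
  rw [coeff_eulerDerivation, ← map_natCast C, coeff_C_mul] at h
  have h2 : j.degree = n := by exact_mod_cast mul_right_cancel₀ hj h
  rw [← h2, Finsupp.degree_eq_weight_one]
  rfl

/-- Eigenvectors of the Euler derivation have natural eigenvalues. -/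
theorem eq_natCast_of_eulerDerivation_eq {p l : MvPolynomial σ ℂ} (hp0 : p ≠ 0)
    (hp : eulerDerivation σ p = l * p) : ∃ n : ℕ, l = n := by
  have hdeg : (eulerDerivation σ p).totalDegree ≤ p.totalDegree :=
    totalDegree_le_of_support_subset fun j hj => by
      rw [mem_support_iff, coeff_eulerDerivation] at hj
      exact mem_support_iff.mpr (right_ne_zero_of_mul hj)
  obtain ⟨c, rfl⟩ : ∃ c, l = C c := by
    by_cases hl0 : l = 0
    · exact ⟨0, by simp [hl0]⟩
    rw [hp, totalDegree_mul_of_isDomain hl0 hp0] at hdeg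
    exact ⟨_, totalDegree_eq_zero_iff_eq_C.mp (by omega)⟩
  obtain ⟨j, hj⟩ := support_nonempty.mpr hp0
  have h := congrArg (coeff j) hp
  rw [coeff_eulerDerivation, coeff_C_mul] at h
  refine ⟨j.degree, ?_⟩
  rw [← mul_right_cancel₀ (mem_support_iff.mp hj) h, map_natCast]

end Euler

section Swap

variable {σ : Type*}

/-- The exchange of the two groups of variables. -/
noncomputable def swapVars (σ : Type*) :
    MvPolynomial σ (MvPolynomial σ ℂ) →+* MvPolynomial σ (MvPolynomial σ ℂ) :=
  eval₂Hom (map C) fun i => C (X i)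

theorem swapVars_C (a : MvPolynomial σ ℂ) : swapVars σ (C a) = map C a := by
  simp [swapVars]

theorem swapVars_map_C (a : MvPolynomial σ ℂ) : swapVars σ (map C a) = C a := by
  have : ((swapVars σ).comp (map C)) = C := by
    ext <;> simp [swapVars]
  exact congrArg (fun f => f a) this

theorem swapVars_swapVars (p : MvPolynomial σ (MvPolynomial σ ℂ)) :
    swapVars σ (swapVars σ p) = p := by
  have : (swapVars σ).comp (swapVars σ) = RingHom.id _ := by
    ext <;> simp [swapVars]
  exact congrArg (fun f => f p) this

theorem isHomogeneous_swapVars {p : MvPolynomial σ (MvPolynomial σ ℂ)} {s : ℕ}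
    (hp : ∀ j, (coeff j p).IsHomogeneous s) : (swapVars σ p).IsHomogeneous s := by
  rw [swapVars, coe_eval₂Hom, eval₂_eq]
  refine IsHomogeneous.sum _ _ _ fun j _ => ?_
  simp only [← map_pow, ← map_prod]
  exact ((hp j).map C).mul (isHomogeneous_C _ _)

theorem eval_X_map_C (a : MvPolynomial σ ℂ) :
    eval (X : σ → MvPolynomial σ ℂ) (map C a) = a := by
  rw [eval_map, eval₂_eta]

theorem coeffDerivation_map_C (d : Derivation ℂ (MvPolynomial σ ℂ) (MvPolynomial σ ℂ))
    (a : MvPolynomial σ ℂ) :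
    coeffDerivation d (map C a : MvPolynomial σ (MvPolynomial σ ℂ)) = 0 := by
  ext1 j
  rw [coeff_coeffDerivation, coeff_map, coeff_zero]
  exact d.map_algebraMap _

end Swap

section FirstIntegral

/-- A polynomial in two groups of variables that vanishes on the diagonal is not the product of
a polynomial in each group. -/
theorem exists_linearIndependent_coeff {σ : Type*} {q : MvPolynomial σ (MvPolynomial σ ℂ)}
    (hq0 : q ≠ 0) (hq : eval X q = 0) : ∃ j k, LinearIndependent ℂ ![coeff j q, coeff k q] := by
  obtain ⟨j, hj⟩ := support_nonempty.mpr hq0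
  have hPj : coeff j q ≠ 0 := mem_support_iff.mp hj
  by_contra! hne
  have hsmul : ∀ k, ∃ a : ℂ, a • coeff j q = coeff k q := fun k => by
    have h := hne j k
    rw [LinearIndependent.pair_iff' hPj] at h
    push Not at h
    exact h
  choose a ha using hsmul
  set r : MvPolynomial σ ℂ := ∑ k ∈ q.support, monomial k (a k) with hr
  have hqr : q = C (coeff j q) * map C r := by
    conv_lhs => rw [← support_sum_monomial_coeff q]
    rw [hr, map_sum, Finset.mul_sum]
    refine Finset.sum_congr rfl fun k _ => ?_
    rw [map_monomial, C_mul_monomial, ← ha k, smul_eq_C_mul, mul_comm]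
  rw [hqr, map_mul, eval_C, eval_X_map_C] at hq
  rw [(mul_eq_zero.mp hq).resolve_left hPj, map_zero, mul_zero] at hqr
  exact hq0 hqr

theorem exists_prime_dvd_map_eq_zero {A B : Type*} [CommRing A] [IsDomain A]
    [UniqueFactorizationMonoid A] [CommRing B] [IsDomain B] (f : A →+* B) {p : A} (hp0 : p ≠ 0)
    (hp : f p = 0) : ∃ q, Prime q ∧ q ∣ p ∧ f q = 0 := by
  obtain ⟨u, hu⟩ := UniqueFactorizationMonoid.factors_prod hp0
  rw [← hu, map_mul] at hp
  have h := (mul_eq_zero.mp hp).resolve_right ((u.isUnit.map f).ne_zero)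
  rw [map_multiset_prod, Multiset.prod_eq_zero_iff, Multiset.mem_map] at h
  obtain ⟨q, hq, hq0⟩ := h
  exact ⟨q, UniqueFactorizationMonoid.prime_of_factor q hq,
    UniqueFactorizationMonoid.dvd_of_mem_factors hq, hq0⟩

theorem MvPolynomial.IsHomogeneous.totalDegree_eq_zero {σ A : Type*} [CommSemiring A]
    {p : MvPolynomial σ A} (hp : p.IsHomogeneous 0) : p.totalDegree = 0 :=
  Nat.le_zero.mp hp.totalDegree_le

theorem hasRatFirstIntegral_one_of_eq
    {D : Derivation ℂ (MvPolynomial (Fin 3) ℂ) (MvPolynomial (Fin 3) ℂ)}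
    (h : D (X 1) * X 2 = D (X 2) * X 1) : HasRatFirstIntegral D 1 := by
  refine ⟨X 1, X 2, isHomogeneous_X _ _, isHomogeneous_X _ _, ?_, by
    linear_combination h⟩
  have h := (linearIndependent_X (Fin 3) ℂ).comp ![1, 2] (by decide)
  have hX : X ∘ ![1, 2] = ![X 1, (X 2 : MvPolynomial (Fin 3) ℂ)] := by
    ext1 i
    fin_cases i <;> rfl
  rwa [hX] at h

/-- A relation of degree at most `n` on the generic point whose coefficients are constants of `D`
of degree zero yields a rational first integral of degree at most `n`. -/
theorem exists_hasRatFirstIntegral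
    (D : Derivation ℂ (MvPolynomial (Fin 3) ℂ) (MvPolynomial (Fin 3) ℂ))
    {p : MvPolynomial (Fin 3) (MvPolynomial (Fin 3) ℂ)} (hp0 : p ≠ 0) (hpx : eval X p = 0)
    (hD : IsProjConst D p) (hE : IsProjConst (eulerDerivation (Fin 3)) p) :
    ∃ s, 1 ≤ s ∧ s ≤ p.totalDegree ∧ HasRatFirstIntegral D s := by
  obtain ⟨q, hq, hqp, hqx⟩ := exists_prime_dvd_map_eq_zero (eval X) hp0 hpx
  have hqdeg : q.totalDegree ≠ 0 := fun h => hq.ne_zero (by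
    rw [totalDegree_eq_zero_iff_eq_C] at h
    rw [h, eval_C] at hqx
    rw [h, hqx, C_0])
  have hqn := totalDegree_le_of_dvd_of_isDomain hqp hp0
  by_cases hpar : D (X 1) * X 2 = D (X 2) * X 1
  · exact ⟨1, le_rfl, by omega, hasRatFirstIntegral_one_of_eq hpar⟩
  obtain ⟨l, hl⟩ := hD.exists_eq_C_mul_of_prime_dvd hp0 hq hqp hqdeg
  obtain ⟨t, ht⟩ := hE.exists_eq_C_mul_of_prime_dvd hp0 hq hqp hqdeg
  have hlc : ∀ i, D (coeff i q) = l * coeff i q := fun i => by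
    rw [← coeff_coeffDerivation, hl, coeff_C_mul]
  have htc : ∀ i, eulerDerivation (Fin 3) (coeff i q) = t * coeff i q := fun i => by
    rw [← coeff_coeffDerivation, ht, coeff_C_mul]
  obtain ⟨j, k, hjk⟩ := exists_linearIndependent_coeff hq.ne_zero hqx
  have hj0 : coeff j q ≠ 0 := hjk.ne_zero 0
  obtain ⟨s, rfl⟩ := eq_natCast_of_eulerDerivation_eq hj0 (htc j)
  have hhom : ∀ i, (coeff i q).IsHomogeneous s := fun i =>
    isHomogeneous_of_eulerDerivation_eq (htc i)
  refine ⟨s, ?_, le_trans ?_ hqn, coeff j q, coeff k q, hhom j, hhom k, hjk, by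
    rw [hlc, hlc]; ring⟩
  · rw [Nat.one_le_iff_ne_zero]
    rintro rfl
    have hj := totalDegree_eq_zero_iff_eq_C.mp (hhom j).totalDegree_eq_zero
    have hk := totalDegree_eq_zero_iff_eq_C.mp (hhom k).totalDegree_eq_zero
    rw [LinearIndependent.pair_iff' hj0] at hjk
    have hc : coeff 0 (coeff j q) ≠ 0 := fun h => hj0 (by rw [hj, h, C_0])
    refine hjk (coeff 0 (coeff k q) / coeff 0 (coeff j q)) ?_
    rw [hj, hk, smul_eq_C_mul, ← C_mul]
    simp [hc]
  set r := C (coeff j q) * map C (coeff k q) - C (coeff k q) * map C (coeff j q) with hr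
  have hswap : swapVars (Fin 3) r = -r := by
    rw [hr, map_sub, map_mul, map_mul, swapVars_C, swapVars_C, swapVars_map_C, swapVars_map_C]
    ring
  have hr0 : r ≠ 0 := fun h => by
    rw [LinearIndependent.pair_iff' hj0] at hjk
    obtain ⟨i, hi⟩ := support_nonempty.mpr hj0
    rw [mem_support_iff] at hi
    refine hjk (coeff i (coeff k q) / coeff i (coeff j q)) ?_
    have h2 := congrArg (coeff i) h
    rw [hr, coeff_sub, coeff_C_mul, coeff_C_mul, coeff_map, coeff_map, coeff_zero] at h2
    have h3 : C (coeff i (coeff j q)) * C (coeff i (coeff j q))⁻¹ =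
        (1 : MvPolynomial (Fin 3) ℂ) := by
      rw [← C_mul, mul_inv_cancel₀ hi, C_1]
    rw [smul_eq_C_mul, div_eq_mul_inv, C_mul]
    linear_combination C (coeff i (coeff j q))⁻¹ * h2 + coeff k q * h3
  have hder : ∀ (d : Derivation ℂ _ _) (a : MvPolynomial (Fin 3) ℂ),
      (∀ i, d (coeff i q) = a * coeff i q) → coeffDerivation d r = C a * r := fun d a hd => by
    rw [hr, map_sub, Derivation.leibniz, Derivation.leibniz, coeffDerivation_map_C,
      coeffDerivation_map_C, coeffDerivation_C, coeffDerivation_C, hd, hd]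
    simp only [smul_eq_mul, C_mul]
    ring
  have hrx : eval X r = 0 := by
    rw [hr, map_sub, map_mul, map_mul, eval_C, eval_C, eval_X_map_C, eval_X_map_C]
    ring
  obtain ⟨h, hqh⟩ : q ∣ r := hq.irreducible.dvd_of_eval_eq_zero (x := X)
    (e := eulerDerivation (Fin 3)) (by simpa [eulerDerivation] using hpar)
    hl ht (hder _ _ hlc) (hder _ _ htc) hqx hrx
  have hh0 : h ≠ 0 := by
    rintro rfl
    exact hr0 (by rw [hqh, mul_zero])
  have hhE : coeffDerivation (eulerDerivation (Fin 3)) h = 0 := by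
    have h1 := hder _ _ htc
    rw [hqh, Derivation.leibniz, ht, smul_eq_mul, smul_eq_mul] at h1
    exact (mul_eq_zero.mp (show q * _ = 0 by linear_combination h1)).resolve_left hq.ne_zero
  obtain ⟨g, rfl⟩ : ∃ g, map C g = h := by
    have : h ∈ Set.range (map C : MvPolynomial (Fin 3) ℂ →+* MvPolynomial (Fin 3) _) := by
      rw [mem_range_map_iff_coeffs_subset]
      intro c hc
      obtain ⟨i, hi, rfl⟩ := mem_coeffs_iff.mp hc
      have h1 := congrArg (coeff i) hhE
      rw [coeff_coeffDerivation, coeff_zero] at h1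
      have h2 := isHomogeneous_of_eulerDerivation_eq (n := 0) (p := coeff i h) (by simpa using h1)
      exact ⟨_, (totalDegree_eq_zero_iff_eq_C.mp
        h2.totalDegree_eq_zero).symm⟩
    exact this
  have hg0 : g ≠ 0 := by
    rintro rfl
    exact hh0 (map_zero _)
  rw [hqh, map_mul, swapVars_map_C] at hswap
  have hdvd : q ∣ swapVars (Fin 3) q * C g := ⟨-map C g, by rw [hswap]; ring⟩
  have hqs : q ∣ swapVars (Fin 3) q := by
    refine (hq.dvd_or_dvd hdvd).resolve_right fun hqg => hqdeg ?_
    have := totalDegree_le_of_dvd_of_isDomain hqg (by simpa using hg0)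
    rw [totalDegree_C] at this
    omega
  have hsq : swapVars (Fin 3) q ∣ q := by
    have := map_dvd (swapVars (Fin 3)) hqs
    rwa [swapVars_swapVars] at this
  have hs0 : swapVars (Fin 3) q ≠ 0 := fun h => hq.ne_zero (by
    rw [← swapVars_swapVars q, h, map_zero])
  rw [← (isHomogeneous_swapVars hhom).totalDegree hs0]
  exact totalDegree_le_of_dvd_of_isDomain hsq hq.ne_zero

end FirstIntegral

section Extactic

variable {σ : Type*}
  {D : Derivation ℂ (MvPolynomial σ ℂ) (MvPolynomial σ ℂ)} {m : ℕ}

theorem derivation_eq_sum_pderiv [Fintype σ]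
    (D : Derivation ℂ (MvPolynomial σ ℂ) (MvPolynomial σ ℂ))
    (p : MvPolynomial σ ℂ) : D p = ∑ i, pderiv i p * D (X i) := by
  classical
  have hev : ∀ q, (∑ i, D (X i) • (pderiv i : Derivation ℂ (MvPolynomial σ ℂ) _)) q =
      ∑ i, pderiv i q * D (X i) := fun q => by
    have h := congrFun (map_sum (Derivation.coeFnAddMonoidHom (R := ℂ) (A := MvPolynomial σ ℂ)
      (M := MvPolynomial σ ℂ)) (fun i => D (X i) • pderiv i) Finset.univ) q
    rw [Finset.sum_apply] at h
    exact h.trans (Finset.sum_congr rfl fun i _ => mul_comm _ _)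
  rw [← hev]
  congr 1
  refine derivation_ext fun j => ?_
  rw [hev, Finset.sum_eq_single j]
  · simp
  · intro i _ hij
    rw [pderiv_X_of_ne hij.symm, zero_mul]
  · simp

theorem isHomogeneous_derivation [Fintype σ] (hD : ∀ i, (D (X i)).IsHomogeneous (m + 1))
    {p : MvPolynomial σ ℂ} {k : ℕ} (hp : p.IsHomogeneous k) : (D p).IsHomogeneous (k + m) := by
  rw [derivation_eq_sum_pderiv]
  refine IsHomogeneous.sum _ _ _ fun i _ => ?_
  rcases k with _ | k
  · rw [totalDegree_eq_zero_iff_eq_C.mp hp.totalDegree_eq_zero, pderiv_C, zero_mul]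
    exact isHomogeneous_zero _ _ _
  · convert! hp.pderiv.mul (hD i) using 1
    simp only [Nat.add_sub_cancel]
    ring

theorem isHomogeneous_iterate_derivation [Fintype σ] (hD : ∀ i, (D (X i)).IsHomogeneous (m + 1))
    {p : MvPolynomial σ ℂ} {k : ℕ} (hp : p.IsHomogeneous k) (t : ℕ) :
    (D^[t] p).IsHomogeneous (k + t * m) := by
  induction t with
  | zero => simpa using hp
  | succ t ih =>
    rw [Function.iterate_succ_apply']
    convert! isHomogeneous_derivation hD ih using 1
    ring

theorem dvd_iterate_derivation {A : Type*} [CommRing A] [Algebra ℂ A] {d : Derivation ℂ A A}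
    {f l : A} (h : d f = l * f) (t : ℕ) : f ∣ d^[t] f := by
  induction t with
  | zero => exact dvd_rfl
  | succ t ih =>
    obtain ⟨g, hg⟩ := ih
    rw [Function.iterate_succ_apply', hg, Derivation.leibniz, h, smul_eq_mul, smul_eq_mul]
    exact ⟨d g + g * l, by ring⟩

variable {N n : ℕ}

/-- The extactic matrix of `D` with respect to the monomials with exponents `e i`. -/
noncomputable def extacticMatrix (D : Derivation ℂ (MvPolynomial σ ℂ) (MvPolynomial σ ℂ))
    (e : Fin N → σ →₀ ℕ) : Matrix (Fin N) (Fin N) (MvPolynomial σ ℂ) :=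
  Matrix.of fun t i => D^[t] (monomial (e i) 1)

/-- The linear form sending a polynomial `∑ aᵢ • Xᵉⁱ` with coefficients in `ℂ[X]` to
`∑ aᵢ * Dᵗ(Xᵉⁱ)`. -/
noncomputable def iterateForm (D : Derivation ℂ (MvPolynomial σ ℂ) (MvPolynomial σ ℂ))
    (e : Fin N → σ →₀ ℕ) (t : ℕ) :
    MvPolynomial σ (MvPolynomial σ ℂ) →ₗ[MvPolynomial σ ℂ] MvPolynomial σ ℂ :=
  ∑ i, (lcoeff (MvPolynomial σ ℂ) (e i)).smulRight (D^[t] (monomial (e i) 1))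

theorem iterateForm_apply (e : Fin N → σ →₀ ℕ) (t : ℕ) (p : MvPolynomial σ (MvPolynomial σ ℂ)) :
    iterateForm D e t p = ∑ i, coeff (e i) p * D^[t] (monomial (e i) 1) := by
  simp [iterateForm]

theorem derivation_iterateForm (e : Fin N → σ →₀ ℕ) (t : ℕ)
    (p : MvPolynomial σ (MvPolynomial σ ℂ)) :
    D (iterateForm D e t p) =
      iterateForm D e t (coeffDerivation D p) + iterateForm D e (t + 1) p := by
  simp only [iterateForm_apply, map_sum, Derivation.leibniz, coeff_coeffDerivation,
    Function.iterate_succ_apply', smul_eq_mul, ← Finset.sum_add_distrib]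
  exact Finset.sum_congr rfl fun i _ => by ring

theorem eulerDerivation_iterateForm [Fintype σ] (hD : ∀ i, (D (X i)).IsHomogeneous (m + 1))
    {e : Fin N → σ →₀ ℕ} (he : ∀ i, (e i).degree = n) (t : ℕ)
    (p : MvPolynomial σ (MvPolynomial σ ℂ)) :
    eulerDerivation σ (iterateForm D e t p) =
      iterateForm D e t (coeffDerivation (eulerDerivation σ) p) +
        ((n + t * m : ℕ) : MvPolynomial σ ℂ) * iterateForm D e t p := by
  have h : ∀ i, eulerDerivation σ (D^[t] (monomial (e i) 1)) =
      ((n + t * m : ℕ) : MvPolynomial σ ℂ) * D^[t] (monomial (e i) 1) := fun i =>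
    (isHomogeneous_iterate_derivation hD (isHomogeneous_monomial 1 (he i)) t).eulerDerivation_eq
  simp only [iterateForm_apply, map_sum, Derivation.leibniz, coeff_coeffDerivation, h,
    smul_eq_mul, Finset.mul_sum, ← Finset.sum_add_distrib]
  exact Finset.sum_congr rfl fun i _ => by ring

theorem eq_sum_monomial {A : Type*} [CommRing A] {e : Fin N → σ →₀ ℕ}
    (he : Function.Injective e) (hsurj : ∀ j : σ →₀ ℕ, j.degree = n → ∃ i, e i = j)
    {p : MvPolynomial σ A} (hp : p.IsHomogeneous n) :
    p = ∑ i, monomial (e i) (coeff (e i) p) := by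
  classical
  ext j
  simp only [coeff_sum, coeff_monomial]
  by_cases hj : j.degree = n
  · obtain ⟨i, rfl⟩ := hsurj j hj
    rw [Finset.sum_eq_single i] <;> simp +contextual [he.eq_iff]
  · have h0 : coeff j p = 0 := hp.coeff_eq_zero hj
    rw [h0, Finset.sum_eq_zero]
    intro i _
    split_ifs with h
    · rw [h, h0]
    · rfl

theorem iterateForm_zero {e : Fin N → σ →₀ ℕ} (he : Function.Injective e)
    (hsurj : ∀ j : σ →₀ ℕ, j.degree = n → ∃ i, e i = j)
    {p : MvPolynomial σ (MvPolynomial σ ℂ)} (hp : p.IsHomogeneous n) :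
    iterateForm D e 0 p = eval X p := by
  conv_rhs => rw [eq_sum_monomial he hsurj hp]
  rw [map_sum, iterateForm_apply]
  refine Finset.sum_congr rfl fun i _ => ?_
  rw [eval_monomial, Function.iterate_zero, id, monomial_eq, C_1, one_mul]

theorem isHomogeneous_coeffDerivation {A : Type*} [CommRing A] [Algebra ℂ A]
    (d : Derivation ℂ A A) {p : MvPolynomial σ A} (hp : p.IsHomogeneous n) :
    (coeffDerivation d p).IsHomogeneous n := by
  intro j hj
  refine hp fun h => hj ?_
  rw [coeff_coeffDerivation, h, map_zero]

/-- If the extactic determinant vanishes, some nonzero form of degree `n` vanishing at the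
generic point is constant up to scaling along `D` and along the Euler derivation. -/
theorem exists_isProjConst_of_det_eq_zero [Fintype σ] (hD : ∀ i, (D (X i)).IsHomogeneous (m + 1))
    {e : Fin N → σ →₀ ℕ} (he : Function.Injective e) (hen : ∀ i, (e i).degree = n)
    (hsurj : ∀ j : σ →₀ ℕ, j.degree = n → ∃ i, e i = j)
    (hdet : (extacticMatrix D e).det = 0) :
    ∃ p : MvPolynomial σ (MvPolynomial σ ℂ), p ≠ 0 ∧ p.IsHomogeneous n ∧ eval X p = 0 ∧
      IsProjConst D p ∧ IsProjConst (eulerDerivation σ) p := by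
  classical
  obtain ⟨v, hv0, hv⟩ := Matrix.exists_vecMul_eq_zero_iff.mpr hdet
  obtain ⟨c, hc0, hc⟩ := Matrix.exists_mulVec_eq_zero_iff.mpr hdet
  obtain ⟨r, hr0, hr⟩ : ∃ r, v r ≠ 0 ∧ ∀ t, r < t → v t = 0 := by
    obtain ⟨r₀, hr₀⟩ := Function.ne_iff.mp hv0
    obtain ⟨r, hr⟩ := Set.Finite.exists_maximal (Set.toFinite {t | v t ≠ 0}) ⟨r₀, hr₀⟩
    refine ⟨r, hr.prop, fun t ht => ?_⟩
    by_contra h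
    exact hr.not_gt h ht
  have hrel : ∀ p, ∑ t : Fin N, v t * iterateForm D e t p = 0 := fun p => by
    simp only [iterateForm_apply, Finset.mul_sum]
    rw [Finset.sum_comm]
    refine Finset.sum_eq_zero fun i _ => ?_
    have := congrFun hv i
    simp only [Matrix.vecMul, dotProduct, extacticMatrix, Matrix.of_apply,
      Pi.zero_apply] at this
    rw [← mul_zero (coeff (e i) p), ← this, Finset.mul_sum]
    exact Finset.sum_congr rfl fun t _ => by ring
  have hlast : ∀ p, (∀ t : ℕ, t < r → iterateForm D e t p = 0) → iterateForm D e r p = 0 := by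
    intro p hp
    have := hrel p
    rw [Finset.sum_eq_single r] at this
    · exact (mul_eq_zero.mp this).resolve_left hr0
    · intro t _ htr
      rcases lt_or_gt_of_ne htr with h | h
      · rw [hp t h, mul_zero]
      · rw [hr t h, zero_mul]
    · simp
  let W : Submodule (MvPolynomial σ ℂ) (MvPolynomial σ (MvPolynomial σ ℂ)) :=
    homogeneousSubmodule σ _ n ⊓ ⨅ t : Fin r, LinearMap.ker (iterateForm D e t)
  have hmem : ∀ p, p ∈ W ↔
      p.IsHomogeneous n ∧ ∀ t : ℕ, t < r → iterateForm D e t p = 0 := fun p => by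
    simp [W, Submodule.mem_iInf, Fin.forall_iff]
  have hW : W ≠ ⊥ := by
    obtain ⟨i, hi⟩ := Function.ne_iff.mp hc0
    have hcoeff : ∀ i, coeff (e i) (∑ i, monomial (e i) (c i)) = c i := fun i => by
      simp [coeff_sum, coeff_monomial, he.eq_iff]
    refine (Submodule.ne_bot_iff _).mpr ⟨∑ i, monomial (e i) (c i), (hmem _).mpr ⟨?_, ?_⟩, ?_⟩
    · exact IsHomogeneous.sum _ _ _ fun i _ => isHomogeneous_monomial _ (hen i)
    · intro t ht
      have := congrFun hc ⟨t, ht.trans r.2⟩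
      simp only [Matrix.mulVec, dotProduct, extacticMatrix, Matrix.of_apply,
        Pi.zero_apply] at this
      rw [iterateForm_apply, ← this]
      exact Finset.sum_congr rfl fun i _ => by rw [hcoeff, mul_comm]
    · intro h
      refine hi ?_
      rw [← hcoeff i, h, coeff_zero, Pi.zero_apply]
  obtain ⟨p, hpW, hp0, hp⟩ := exists_isProjConst hW (S := {D, eulerDerivation σ}) (by
    intro d hd p hp
    rw [hmem] at hp ⊢
    refine ⟨isHomogeneous_coeffDerivation d hp.1, fun t ht => ?_⟩
    have hz := hp.2 t ht
    rcases hd with rfl | rfl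
    · have h := derivation_iterateForm (D := d) e t p
      have hz' : iterateForm d e (t + 1) p = 0 := by
        rcases Nat.lt_or_ge (t + 1) r with h1 | h1
        · exact hp.2 _ h1
        · rw [show t + 1 = r by omega]
          exact hlast p hp.2
      rw [hz, hz', map_zero, add_zero] at h
      exact h.symm
    · have h := eulerDerivation_iterateForm hD hen t p
      rw [hz, mul_zero, map_zero, add_zero] at h
      exact h.symm)
  rw [hmem] at hpW
  refine ⟨p, hp0, hpW.1, ?_, hp _ (by simp), hp _ (by simp)⟩
  rw [← iterateForm_zero (D := D) he hsurj hpW.1]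
  rcases Nat.eq_zero_or_pos r with h | h
  · simpa [h] using hlast p hpW.2
  · exact hpW.2 0 h

theorem dvd_det_extacticMatrix {e : Fin N → σ →₀ ℕ} (he : Function.Injective e)
    (hsurj : ∀ j : σ →₀ ℕ, j.degree = n → ∃ i, e i = j) {f l : MvPolynomial σ ℂ}
    (hf : f.IsHomogeneous n) (hf0 : f ≠ 0) (h : D f = l * f) :
    f ∣ (extacticMatrix D e).det := by
  classical
  set a : Fin N → MvPolynomial σ ℂ := fun i => C (coeff (e i) f) with ha
  have hMa : ∀ t, f ∣ (extacticMatrix D e).mulVec a t := fun t => by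
    have hlin : ∀ p, D^[t] p = ((D : MvPolynomial σ ℂ →ₗ[ℂ] MvPolynomial σ ℂ) ^ (t : ℕ)) p :=
      fun p => (Module.End.pow_apply (D : MvPolynomial σ ℂ →ₗ[ℂ] MvPolynomial σ ℂ) _ _).symm
    have heq : D^[t] f = (extacticMatrix D e).mulVec a t := by
      rw [hlin, eq_sum_monomial he hsurj hf, map_sum, Matrix.mulVec, dotProduct]
      refine Finset.sum_congr rfl fun i _ => ?_
      rw [extacticMatrix, Matrix.of_apply, ha, mul_comm,
        ← smul_eq_C_mul, hlin, ← map_smul, smul_monomial, smul_eq_mul, mul_one]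
    exact heq ▸ dvd_iterate_derivation h t
  obtain ⟨i, hi⟩ : ∃ i, coeff (e i) f ≠ 0 := by
    by_contra! hall
    refine hf0 ?_
    rw [eq_sum_monomial he hsurj hf]
    simp [hall]
  have hdvd : f ∣ (extacticMatrix D e).det * a i := by
    have h1 : (extacticMatrix D e).adjugate.mulVec ((extacticMatrix D e).mulVec a) i =
        (extacticMatrix D e).det * a i := by
      rw [Matrix.mulVec_mulVec, Matrix.adjugate_mul, Matrix.smul_mulVec, Matrix.one_mulVec,
        Pi.smul_apply, smul_eq_mul]
    rw [← h1, Matrix.mulVec, dotProduct]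
    exact Finset.dvd_sum fun t _ => (hMa t).mul_left _
  exact ((hi.isUnit.map (C : ℂ →+* MvPolynomial σ ℂ)).dvd_mul_right).mp hdvd

theorem isHomogeneous_det_extacticMatrix [Fintype σ] (hD : ∀ i, (D (X i)).IsHomogeneous (m + 1))
    {e : Fin N → σ →₀ ℕ} (hen : ∀ i, (e i).degree = n) :
    (extacticMatrix D e).det.IsHomogeneous (∑ t : Fin N, (n + t * m)) := by
  rw [← Matrix.det_transpose, Matrix.det_apply]
  refine IsHomogeneous.sum _ _ _ fun s _ => ?_
  have h : (∏ t, (extacticMatrix D e).transpose (s t) t).IsHomogeneous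
      (∑ t : Fin N, (n + t * m)) := IsHomogeneous.prod _ _ _ fun t _ =>
    isHomogeneous_iterate_derivation hD (isHomogeneous_monomial 1 (hen _)) t
  rcases Int.units_eq_one_or (Equiv.Perm.sign s) with hs | hs <;> rw [hs]
  · simpa using h
  · simpa using h.neg

end Extactic

theorem exists_enumeration_degree_eq (n : ℕ) :
    ∃ e : Fin ((n + 2).choose n) → Fin 3 →₀ ℕ, Function.Injective e ∧
      (∀ i, (e i).degree = n) ∧ ∀ j : Fin 3 →₀ ℕ, j.degree = n → ∃ i, e i = j := by
  have hcard : Fintype.card (Finset.finsuppAntidiag (Finset.univ : Finset (Fin 3)) n) =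
      (n + 2).choose n := by
    rw [Fintype.card_coe, Finset.card_finsuppAntidiag_nat_eq_choose, Finset.card_univ,
      Fintype.card_fin]
    congr 1
    omega
  have hmem : ∀ j : Fin 3 →₀ ℕ, j ∈ Finset.finsuppAntidiag Finset.univ n ↔ j.degree = n :=
    fun j => by simp [Finset.mem_finsuppAntidiag, Finsupp.degree_eq_sum]
  let f := (Fintype.equivFinOfCardEq hcard).symm
  refine ⟨fun i => f i, Subtype.val_injective.comp f.injective, fun i => (hmem _).mp (f i).2,
    fun j hj => ⟨f.symm ⟨j, (hmem j).mpr hj⟩, by simp⟩⟩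

theorem prod_dvd_of_irreducible {σ : Type*} {k : ℕ} {F : Fin k → MvPolynomial σ ℂ}
    {p : MvPolynomial σ ℂ} (hirr : ∀ i, Irreducible (F i))
    (hF : ∀ i j, i ≠ j → ∀ c : ℂ, F i ≠ c • F j) (hdvd : ∀ i, F i ∣ p) : ∏ i, F i ∣ p := by
  refine Fintype.prod_dvd_of_isRelPrime (fun i j hij => ?_) hdvd
  refine (hirr i).isRelPrime_iff_not_dvd.mpr fun h => ?_
  obtain ⟨u, hu⟩ := ((hirr i).associated_of_dvd (hirr j) h)
  obtain ⟨c, -, hc⟩ := MvPolynomial.isUnit_iff_eq_C_of_isReduced.mp u.isUnit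
  refine hF j i hij.symm c ?_
  rw [← hu, hc, smul_eq_C_mul, mul_comm]

theorem le_of_mul_le_sum {k m n : ℕ} (hn : 1 ≤ n)
    (h : k * n ≤ ∑ t : Fin ((n + 2).choose n), (n + t * m)) :
    8 * k + n ^ 3 + 2 * n ^ 2 ≤ (m + 1) * (n ^ 3 + 6 * n ^ 2 + 11 * n + 6) + n + 2 := by
  obtain ⟨N, hN⟩ : ∃ N, (n + 2).choose n = N := ⟨_, rfl⟩
  have hN2 : 2 * N = (n + 2) * (n + 1) := by
    rw [← hN, Nat.choose_symm_add, Nat.choose_two_right, Nat.mul_div_cancel']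
    · rfl
    · exact (Nat.even_mul_pred_self _).two_dvd
  rw [hN, Finset.sum_add_distrib, ← Finset.sum_mul, Fin.sum_univ_eq_sum_range (fun t => t)] at h
  have hs : (∑ t ∈ Finset.range N, t) * 2 + N = N * N := by
    rw [Finset.sum_range_id_mul_two]
    rcases N with _ | N
    · rfl
    · simp only [Nat.add_sub_cancel]; ring
  simp only [Finset.sum_const, Finset.card_univ, Fintype.card_fin, smul_eq_mul] at h
  generalize ∑ t ∈ Finset.range N, t = s at h hs
  zify at *
  have hNval : (N : ℤ) * N * 4 = (n + 2) ^ 2 * (n + 1) ^ 2 := by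
    linear_combination (2 * (N : ℤ) + (n + 2) * (n + 1)) * hN2
  have hsval : (s : ℤ) * 8 = (n + 2) * (n + 1) * (n * (n + 3)) := by
    linear_combination 4 * hs + hNval - 2 * hN2
  refine le_of_mul_le_mul_left ?_ (show (0 : ℤ) < n by linarith)
  linear_combination 8 * h + m * hsval + 4 * n * hN2

/-- For a derivation `D = a·∂x + b·∂y + c·∂z` with `a,b,c` homogeneous of the same degree
`m ≥ 1` admitting no rational first integral of degree `≤ n`, the number of pairwise
non-associated irreducible homogeneous invariant polynomials of degree exactly `n` is at
most `(m(n³+6n²+11n+6) − n³ − 2n² + n + 2)/8`. -/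
theorem extactic_stmt_7
    (D : Derivation ℂ (MvPolynomial (Fin 3) ℂ) (MvPolynomial (Fin 3) ℂ))
    (m : ℕ) (hm : 1 ≤ m)
    (hhom : ∀ i : Fin 3, (D (X i)).IsHomogeneous m)
    (n : ℕ) (hn : 1 ≤ n)
    (hnofi : ∀ e, 1 ≤ e → e ≤ n → ¬ HasRatFirstIntegral D e)
    (k : ℕ) (F : Fin k → MvPolynomial (Fin 3) ℂ)
    (hirr : ∀ i, Irreducible (F i))
    (hFhom : ∀ i, (F i).IsHomogeneous n)
    (hinv : ∀ i, ∃ L : MvPolynomial (Fin 3) ℂ, D (F i) = L * F i)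
    (hnonassoc : ∀ i j, i ≠ j → ∀ c : ℂ, F i ≠ c • F j) :
    k ≤ (m * (n ^ 3 + 6 * n ^ 2 + 11 * n + 6) + n + 2 - n ^ 3 - 2 * n ^ 2) / 8 := by
  obtain ⟨m, rfl⟩ := Nat.exists_eq_add_of_le' hm
  obtain ⟨e, he, hen, hsurj⟩ := exists_enumeration_degree_eq n
  have hdet : (extacticMatrix D e).det ≠ 0 := fun h => by
    obtain ⟨p, hp0, hpn, hpx, hpD, hpE⟩ :=
      exists_isProjConst_of_det_eq_zero hhom he hen hsurj h
    obtain ⟨s, hs1, hs, hint⟩ := exists_hasRatFirstIntegral D hp0 hpx hpD hpE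
    exact hnofi s hs1 (hs.trans hpn.totalDegree_le) hint
  have hdvd : ∏ i, F i ∣ (extacticMatrix D e).det :=
    prod_dvd_of_irreducible hirr hnonassoc fun i => by
      obtain ⟨L, hL⟩ := hinv i
      exact dvd_det_extacticMatrix he hsurj (hFhom i) (hirr i).ne_zero hL
  have hprod : (∏ i, F i).IsHomogeneous (∑ _i : Fin k, n) :=
    IsHomogeneous.prod _ _ _ fun i _ => hFhom i
  have hdeg := totalDegree_le_of_dvd_of_isDomain hdvd hdet
  rw [hprod.totalDegree (Finset.prod_ne_zero_iff.mpr fun i _ => (hirr i).ne_zero),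
    (isHomogeneous_det_extacticMatrix hhom hen).totalDegree hdet, Finset.sum_const,
    Finset.card_univ, Fintype.card_fin, smul_eq_mul] at hdeg
  have := le_of_mul_le_sum hn hdeg
  rw [Nat.le_div_iff_mul_le (by norm_num)]
  omega
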